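/- arXiv:2207.14342 — 2 statements merged into one kernel-verified Lean document; each statement's English description precedes it below -/
import Mathlib

section
/- Let κ be a perfect kernel on X, f an external field, A ⊆ X with w_f(A) < ∞, and let ξ := ξ_{A,f} be the extremal measure (the common limit, in the strong metric d and vaguely, of all minimizing sequences in Ĕ⁺_f(A)). Then a solution of the inner Gauss variational problem for (A, f) exists if and only if ξ ∈ Ĕ⁺(A), i.e. ξ is concentrated on A and ξ(X) = 1; and in the affirmative case the solution equals ξ. -/
open MeasureTheory Topology Filter Set ENNReal

noncomputable section

namespace GaussVar

variable {X : Type*} [TopologicalSpace X] [MeasurableSpace X]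

/-- A (positive) Radon measure: a regular Borel measure. -/
def IsRadon (μ : Measure X) : Prop := μ.Regular

/-- The mutual energy `I(μ,ν) = ∬ κ(x,y) d(μ⊗ν)(x,y)`. -/
def mutualEnergy (κ : X → X → ℝ≥0∞) (μ ν : Measure X) : ℝ≥0∞ :=
  ∫⁻ p : X × X, κ p.1 p.2 ∂(μ.prod ν)

/-- The energy `I(μ) := I(μ,μ)`. -/
def energy (κ : X → X → ℝ≥0∞) (μ : Measure X) : ℝ≥0∞ := mutualEnergy κ μ μ

/-- Membership in the cone `E⁺` of Radon measures with finite energy. -/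
def memEplus (κ : X → X → ℝ≥0∞) (μ : Measure X) : Prop :=
  IsRadon μ ∧ energy κ μ < ⊤

/-- A kernel: symmetric and lower semicontinuous with values in `[0,∞]`. -/
def IsKernel (κ : X → X → ℝ≥0∞) : Prop :=
  (∀ x y, κ x y = κ y x) ∧ LowerSemicontinuous (fun p : X × X => κ p.1 p.2)

/-- The strong (energy) metric `d(μ,ν) := (I(μ)+I(ν)−2I(μ,ν))^{1/2}` on `E⁺`. -/
def strongDist (κ : X → X → ℝ≥0∞) (μ ν : Measure X) : ℝ :=
  Real.sqrt ((energy κ μ).toReal + (energy κ ν).toReal - 2 * (mutualEnergy κ μ ν).toReal)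

/-- The energy principle (strict positive definiteness). -/
def EnergyPrinciple (κ : X → X → ℝ≥0∞) : Prop :=
  ∀ μ ν : Measure X, memEplus κ μ → memEplus κ ν →
    2 * mutualEnergy κ μ ν ≤ energy κ μ + energy κ ν ∧
      (2 * mutualEnergy κ μ ν = energy κ μ + energy κ ν → μ = ν)

/-- Convergence of a sequence in the strong metric. -/
def StrongTendstoSeq (κ : X → X → ℝ≥0∞) (μ : ℕ → Measure X) (μ₀ : Measure X) : Prop :=
  Tendsto (fun n => strongDist κ (μ n) μ₀) atTop (𝓝 0)

/-- Vague convergence of a sequence of measures. -/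
def VagueTendstoSeq (μ : ℕ → Measure X) (μ₀ : Measure X) : Prop :=
  ∀ φ : X → ℝ, Continuous φ → HasCompactSupport φ →
    Tendsto (fun n => ∫ x, φ x ∂(μ n)) atTop (𝓝 (∫ x, φ x ∂μ₀))

/-- Cauchy sequence in the strong metric. -/
def StrongCauchySeq (κ : X → X → ℝ≥0∞) (μ : ℕ → Measure X) : Prop :=
  ∀ ε : ℝ, 0 < ε → ∃ N : ℕ, ∀ m ≥ N, ∀ n ≥ N, strongDist κ (μ m) (μ n) < ε

/-- A perfect kernel: satisfies the energy principle, `(E⁺,d)` is complete, and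
strong convergence implies vague convergence. -/
def IsPerfect (κ : X → X → ℝ≥0∞) : Prop :=
  EnergyPrinciple κ ∧
    (∀ μ : ℕ → Measure X, (∀ n, memEplus κ (μ n)) → StrongCauchySeq κ μ →
        ∃ μ₀ : Measure X, memEplus κ μ₀ ∧ StrongTendstoSeq κ μ μ₀) ∧
    (∀ (μ : ℕ → Measure X) (μ₀ : Measure X), (∀ n, memEplus κ (μ n)) → memEplus κ μ₀ →
        StrongTendstoSeq κ μ μ₀ → VagueTendstoSeq μ μ₀)

/-- `μ` is concentrated on `A`: the complement of `A` is locally `μ`-negligible. -/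
def Concentrated (μ : Measure X) (A : Set X) : Prop :=
  ∀ K : Set X, IsCompact K → μ (Aᶜ ∩ K) = 0

/-- Membership in `Ĕ⁺(A)`: finite-energy Radon measures concentrated on `A`
of unit total mass. -/
def memBreve (κ : X → X → ℝ≥0∞) (A : Set X) (μ : Measure X) : Prop :=
  memEplus κ μ ∧ Concentrated μ A ∧ μ Set.univ = 1

/-- `w(A) := inf { I(μ) : μ ∈ Ĕ⁺(A) }` (with `inf ∅ = ⊤`). -/
def wcap (κ : X → X → ℝ≥0∞) (A : Set X) : ℝ≥0∞ :=
  ⨅ (μ : Measure X) (_ : memBreve κ A μ), energy κ μ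

/-- The inner capacity `cap_*(A) := 1 / w(A)`. -/
def innerCap (κ : X → X → ℝ≥0∞) (A : Set X) : ℝ≥0∞ := (wcap κ A)⁻¹

/-- The outer capacity `cap^*(E) := inf { cap_*(D) : D open, E ⊆ D }`. -/
def outerCap (κ : X → X → ℝ≥0∞) (E : Set X) : ℝ≥0∞ :=
  ⨅ (D : Set X) (_ : IsOpen D ∧ E ⊆ D), innerCap κ D

/-- `P` holds nearly everywhere (n.e.) on `A`: the exceptional subset of `A`
has inner capacity zero. -/
def NearlyEverywhere (κ : X → X → ℝ≥0∞) (A : Set X) (P : X → Prop) : Prop :=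
  innerCap κ {x ∈ A | ¬ P x} = 0

/-- The potential `U^μ(x) := ∫ κ(x,y) dμ(y)`. -/
def potential (κ : X → X → ℝ≥0∞) (μ : Measure X) (x : X) : ℝ≥0∞ :=
  ∫⁻ y, κ x y ∂μ

/-- An external field: `f = ψ + U^{ϑ⁺} − U^{ϑ⁻}` where `ψ` is lower semicontinuous,
`(−∞,∞]`-valued, positive if `X` is noncompact, and `ϑ⁺, ϑ⁻ ∈ E⁺`. -/
def IsExternalField (κ : X → X → ℝ≥0∞) (f : X → EReal) : Prop :=
  ∃ (ψ : X → EReal) (ϑp ϑm : Measure X),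
    LowerSemicontinuous ψ ∧ (∀ x, ψ x ≠ ⊥) ∧ (¬ CompactSpace X → ∀ x, 0 ≤ ψ x) ∧
    memEplus κ ϑp ∧ memEplus κ ϑm ∧
    ∀ x, f x = ψ x + (potential κ ϑp x : EReal) - (potential κ ϑm x : EReal)

/-- `f` is `μ`-integrable (as an extended-real-valued function). -/
def FieldIntegrable (f : X → EReal) (μ : Measure X) : Prop :=
  Integrable (fun x => (f x).toReal) μ ∧ (∀ᵐ x ∂μ, f x ≠ ⊤ ∧ f x ≠ ⊥)

/-- `∫ f dμ` for an a.e.-finite integrable field. -/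
def fieldIntegral (f : X → EReal) (μ : Measure X) : ℝ := ∫ x, (f x).toReal ∂μ

/-- The Gauss functional `I_f(μ) := I(μ) + 2 ∫ f dμ`. -/
def gaussI (κ : X → X → ℝ≥0∞) (f : X → EReal) (μ : Measure X) : ℝ :=
  (energy κ μ).toReal + 2 * fieldIntegral f μ

/-- Membership in `Ĕ⁺_f(A)`. -/
def Admissible (κ : X → X → ℝ≥0∞) (A : Set X) (f : X → EReal) (μ : Measure X) : Prop :=
  memBreve κ A μ ∧ FieldIntegrable f μ

/-- `w_f(A) := inf { I_f(μ) : μ ∈ Ĕ⁺_f(A) }` (with `inf ∅ = ⊤`). -/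
def wf (κ : X → X → ℝ≥0∞) (A : Set X) (f : X → EReal) : EReal :=
  ⨅ (μ : Measure X) (_ : Admissible κ A f μ), ((gaussI κ f μ : ℝ) : EReal)

/-- `l` is a solution of the inner Gauss variational problem for `(A,f)`. -/
def IsSolution (κ : X → X → ℝ≥0∞) (A : Set X) (f : X → EReal) (l : Measure X) : Prop :=
  Admissible κ A f l ∧ ((gaussI κ f l : ℝ) : EReal) = wf κ A f

/-- The `f`-weighted potential `U_f^μ := U^μ + f`. -/
def wPotential (κ : X → X → ℝ≥0∞) (f : X → EReal) (μ : Measure X) (x : X) : EReal :=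
  (potential κ μ x : EReal) + f x

/-- `∫ U_f^μ dμ`, the weighted equilibrium constant of a solution. -/
def wConst (κ : X → X → ℝ≥0∞) (f : X → EReal) (μ : Measure X) : ℝ :=
  ∫ x, (wPotential κ f μ x).toReal ∂μ

/-- The cone `E⁺(A)` is closed in the strong metric. -/
def StrongClosedEplusOn (κ : X → X → ℝ≥0∞) (A : Set X) : Prop :=
  ∀ (μ : ℕ → Measure X) (μ₀ : Measure X),
    (∀ n, memEplus κ (μ n) ∧ Concentrated (μ n) A) →
    memEplus κ μ₀ → StrongTendstoSeq κ μ μ₀ → Concentrated μ₀ A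

/-- Frostman's (first) maximum principle. -/
def FrostmanMax (κ : X → X → ℝ≥0∞) : Prop :=
  ∀ μ : Measure X, memEplus κ μ →
    (∀ x : X, (∀ U : Set X, IsOpen U → x ∈ U → 0 < μ U) → potential κ μ x ≤ 1) →
    ∀ x : X, potential κ μ x ≤ 1

/-- The domination (second maximum) principle. -/
def DominationPrinciple (κ : X → X → ℝ≥0∞) : Prop :=
  ∀ μ ν : Measure X, memEplus κ μ → memEplus κ ν →
    (∀ᵐ x ∂μ, potential κ μ x ≤ potential κ ν x) →
    ∀ x : X, potential κ μ x ≤ potential κ ν x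

/-- `β` is the inner balayage of `ζ` onto `A`: `β ∈ E⁺(A)` and `U^β = U^ζ` n.e. on `A`. -/
def IsInnerBalayage (κ : X → X → ℝ≥0∞) (A : Set X) (ζ β : Measure X) : Prop :=
  memEplus κ β ∧ Concentrated β A ∧
    NearlyEverywhere κ A (fun x => potential κ β x = potential κ ζ x)

/-- `γ` is the inner capacitary measure of `A`: `γ ∈ E⁺(A)` and `U^γ = 1` n.e. on `A`. -/
def IsCapacitaryMeasure (κ : X → X → ℝ≥0∞) (A : Set X) (γ : Measure X) : Prop :=
  memEplus κ γ ∧ Concentrated γ A ∧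
    NearlyEverywhere κ A (fun x => potential κ γ x = 1)

/-- `A` is quasiclosed: approximable in outer capacity by closed sets. -/
def Quasiclosed (κ : X → X → ℝ≥0∞) (A : Set X) : Prop :=
  ∀ ε : ℝ≥0∞, 0 < ε → ∃ F : Set X, IsClosed F ∧ outerCap κ (symmDiff A F) < ε

/-- `A` is quasicompact: approximable in outer capacity by compact sets. -/
def Quasicompact (κ : X → X → ℝ≥0∞) (A : Set X) : Prop :=
  ∀ ε : ℝ≥0∞, 0 < ε → ∃ K : Set X, IsCompact K ∧ outerCap κ (symmDiff A K) < ε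



/-- The lower staircase approximation of `h` with `(n + 1) ^ 2` steps of height `1 / (n + 1)`. -/
def staircase {X : Type*} (h : X → ℝ≥0∞) (n : ℕ) (x : X) : ℝ≥0∞ :=
  ∑ k ∈ Finset.range ((n + 1) ^ 2),
    {y | ((k + 1 : ℕ) : ℝ≥0∞) / ((n + 1 : ℕ) : ℝ≥0∞) < h y}.indicator
      (fun _ => ((n + 1 : ℕ) : ℝ≥0∞)⁻¹) x

theorem staircase_le {X : Type*} (h : X → ℝ≥0∞) (n : ℕ) (x : X) : staircase h n x ≤ h x := by
  have key : ∀ N : ℕ, ∑ k ∈ Finset.range N,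
      {y | ((k + 1 : ℕ) : ℝ≥0∞) / ((n + 1 : ℕ) : ℝ≥0∞) < h y}.indicator
        (fun _ => ((n + 1 : ℕ) : ℝ≥0∞)⁻¹) x ≤ h x := by
    intro N
    induction N with
    | zero => simp
    | succ N ih =>
      by_cases hN : ((N + 1 : ℕ) : ℝ≥0∞) / ((n + 1 : ℕ) : ℝ≥0∞) < h x
      · refine le_trans ?_ hN.le
        calc _ ≤ ∑ k ∈ Finset.range (N + 1), ((n + 1 : ℕ) : ℝ≥0∞)⁻¹ :=
              Finset.sum_le_sum fun k _ => Set.indicator_le_self' (by simp) x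
          _ = _ := by
              rw [Finset.sum_const, Finset.card_range, nsmul_eq_mul, div_eq_mul_inv]
      · rw [Finset.sum_range_succ, Set.indicator_of_notMem (by exact hN), add_zero]
        exact ih
  exact key _

theorem le_liminf_staircase {X : Type*} (h : X → ℝ≥0∞) (x : X) :
    h x ≤ liminf (fun n => staircase h n x) atTop := by
  refine le_of_forall_lt_imp_le_of_dense fun a ha => ?_
  obtain ⟨b, hab, hb⟩ := ENNReal.lt_iff_exists_nnreal_btwn.1 ha
  lift a to NNReal using (hab.trans coe_lt_top).ne
  have hab' : a < b := by exact_mod_cast hab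
  refine le_liminf_of_le (by isBoundedDefault) ?_
  have h1 : ∀ᶠ n : ℕ in atTop, (b : ℝ) ≤ n := tendsto_natCast_atTop_atTop.eventually_ge_atTop _
  have h2 : ∀ᶠ n : ℕ in atTop, 1 / ((n : ℝ) + 1) < (b : ℝ) - a :=
    tendsto_one_div_add_atTop_nhds_zero_nat.eventually_lt_const
      (sub_pos.2 (by exact_mod_cast hab'))
  filter_upwards [h1, h2] with n hn1 hn2
  set m := ⌊(b : ℝ) * (n + 1)⌋₊ with hm
  have hpos : (0 : ℝ) < (n : ℝ) + 1 := by positivity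
  have hmle : (m : ℝ) ≤ b * (n + 1) := Nat.floor_le (by positivity)
  have hmlt : (b : ℝ) * (n + 1) < m + 1 := Nat.lt_floor_add_one _
  have hm2 : m ≤ (n + 1) ^ 2 := by
    have : (m : ℝ) ≤ ((n + 1) ^ 2 : ℕ) := by
      push_cast; nlinarith
    exact_mod_cast this
  have hsub : Finset.range m ⊆ Finset.range ((n + 1) ^ 2) := Finset.range_mono hm2
  calc (a : ℝ≥0∞) ≤ ∑ k ∈ Finset.range m, ((n + 1 : ℕ) : ℝ≥0∞)⁻¹ := by
        rw [Finset.sum_const, Finset.card_range, nsmul_eq_mul, ← div_eq_mul_inv,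
          ENNReal.le_div_iff_mul_le (by simp) (by simp)]
        have : (a : ℝ) * (n + 1) ≤ m := by
          have := (div_lt_iff₀ hpos).1 hn2
          nlinarith
        have h' : a * ((n + 1 : ℕ) : NNReal) ≤ (m : NNReal) := by
          rw [← NNReal.coe_le_coe]; push_cast; exact this
        exact_mod_cast h'
    _ ≤ ∑ k ∈ Finset.range m, {y | ((k + 1 : ℕ) : ℝ≥0∞) / ((n + 1 : ℕ) : ℝ≥0∞) < h y}.indicator
          (fun _ => ((n + 1 : ℕ) : ℝ≥0∞)⁻¹) x := by
        refine Finset.sum_le_sum fun k hk => ?_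
        rw [Set.indicator_of_mem]
        refine lt_of_le_of_lt ?_ hb
        rw [ENNReal.div_le_iff (by simp) (by simp)]
        have hk' : k + 1 ≤ m := Finset.mem_range.1 hk
        have : ((k + 1 : ℕ) : ℝ) ≤ b * (n + 1) := le_trans (by exact_mod_cast hk') hmle
        have h' : ((k + 1 : ℕ) : NNReal) ≤ b * ((n + 1 : ℕ) : NNReal) := by
          rw [← NNReal.coe_le_coe]; push_cast; push_cast at this; exact this
        exact_mod_cast h'
    _ ≤ _ := Finset.sum_le_sum_of_subset hsub

section Topological

variable {X : Type*} [TopologicalSpace X] [MeasurableSpace X]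

theorem lintegral_staircase [OpensMeasurableSpace X] {h : X → ℝ≥0∞} (hh : LowerSemicontinuous h)
    (n : ℕ) (ν : Measure X) : ∫⁻ x, staircase h n x ∂ν =
      ∑ k ∈ Finset.range ((n + 1) ^ 2), ((n + 1 : ℕ) : ℝ≥0∞)⁻¹ *
        ν {y | ((k + 1 : ℕ) : ℝ≥0∞) / ((n + 1 : ℕ) : ℝ≥0∞) < h y} := by
  have hm : ∀ a, MeasurableSet {y | a < h y} := fun a => (hh.isOpen_preimage a).measurableSet
  unfold staircase
  rw [lintegral_finsetSum _ fun k _ => measurable_const.indicator (hm _)]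
  exact Finset.sum_congr rfl fun k _ => lintegral_indicator_const (hm _) _

theorem lintegral_le_liminf_staircase [OpensMeasurableSpace X] {h : X → ℝ≥0∞}
    (hh : LowerSemicontinuous h) (ν : Measure X) :
    ∫⁻ x, h x ∂ν ≤ liminf (fun n => ∫⁻ x, staircase h n x ∂ν) atTop := by
  have hm : ∀ a, MeasurableSet {y | a < h y} := fun a => (hh.isOpen_preimage a).measurableSet
  refine (lintegral_mono (le_liminf_staircase h)).trans (lintegral_liminf_le fun n => ?_)
  unfold staircase
  exact Finset.measurable_sum _ fun k _ => measurable_const.indicator (hm _)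

theorem measure_iUnion_of_directed_isOpen {ι : Type*} [Nonempty ι] (ν : Measure X) [ν.Regular]
    {U : ι → Set X} (hU : ∀ i, IsOpen (U i)) (hd : Directed (· ⊆ ·) U) :
    ν (⋃ i, U i) = ⨆ i, ν (U i) := by
  refine le_antisymm ?_ (iSup_le fun i => measure_mono (subset_iUnion U i))
  rw [(isOpen_iUnion hU).measure_eq_iSup_isCompact]
  refine iSup₂_le fun K hKU => iSup_le fun hK => ?_
  obtain ⟨i, hi⟩ := hK.elim_directed_cover U hU hKU hd
  exact (measure_mono hi).trans (le_iSup (fun i => ν (U i)) i)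

/-- `τ`-additivity of Radon measures: the integral commutes with directed suprema of lower
semicontinuous functions. -/
theorem lintegral_iSup_of_directed_lowerSemicontinuous [OpensMeasurableSpace X] {ι : Type*}
    [Nonempty ι]
    (ν : Measure X) [ν.Regular] {h : ι → X → ℝ≥0∞} (hh : ∀ i, LowerSemicontinuous (h i))
    (hd : Directed (· ≤ ·) h) : ∫⁻ x, ⨆ i, h i x ∂ν = ⨆ i, ∫⁻ x, h i x ∂ν := by
  refine le_antisymm ?_ (iSup_le fun i => lintegral_mono fun x => le_iSup (fun i => h i x) i)
  refine (lintegral_le_liminf_staircase (lowerSemicontinuous_iSup hh) ν).trans ?_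
  refine (liminf_le_liminf (v := fun _ => ⨆ i, ∫⁻ x, h i x ∂ν) (Eventually.of_forall fun n => ?_)
    (by isBoundedDefault) (by isBoundedDefault)).trans (liminf_const _).le
  have hlev : ∀ a : ℝ≥0∞, ν {y | a < ⨆ i, h i y} = ⨆ i, ν {y | a < h i y} := by
    intro a
    have := measure_iUnion_of_directed_isOpen ν (U := fun i => {y | a < h i y})
      (fun i => (hh i).isOpen_preimage a) (fun i j => (hd i j).imp fun k hk =>
        ⟨fun y hy => lt_of_lt_of_le hy (hk.1 y), fun y hy => lt_of_lt_of_le hy (hk.2 y)⟩)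
    rw [← this]
    congr 1
    ext y
    simp [lt_iSup_iff]
  rw [lintegral_staircase (lowerSemicontinuous_iSup hh)]
  simp_rw [hlev, ENNReal.mul_iSup]
  rw [ENNReal.finsetSum_iSup fun i j => (hd i j).imp fun k hk a =>
    ⟨by gcongr; exact hk.1 _, by gcongr; exact hk.2 _⟩]
  refine iSup_mono fun i => ?_
  rw [← lintegral_staircase (hh i)]
  exact lintegral_mono (staircase_le _ _)

theorem liminf_add_liminf_le (u v : ℕ → ℝ≥0∞) :
    liminf u atTop + liminf v atTop ≤ liminf (fun j => u j + v j) atTop := by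
  simp_rw [liminf_eq_iSup_iInf_of_nat]
  rw [ENNReal.iSup_add_iSup_of_monotone]
  · refine iSup_mono fun n => le_iInf₂ fun i hi => ?_
    exact add_le_add (iInf₂_le i hi) (iInf₂_le i hi)
  all_goals
    exact fun n m hnm => le_iInf₂ fun i hi => iInf₂_le i (hnm.trans hi)

/-- Lower semicontinuity of the integral along sequences of measures. -/
theorem lintegral_le_liminf_of_isOpen [OpensMeasurableSpace X] {μ : ℕ → Measure X} {ν : Measure X}
    (hopen : ∀ G : Set X, IsOpen G → ν G ≤ liminf (fun j => μ j G) atTop)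
    {h : X → ℝ≥0∞} (hh : LowerSemicontinuous h) :
    ∫⁻ x, h x ∂ν ≤ liminf (fun j => ∫⁻ x, h x ∂(μ j)) atTop := by
  refine (lintegral_le_liminf_staircase hh ν).trans ?_
  refine (liminf_le_liminf (v := fun _ => liminf (fun j => ∫⁻ x, h x ∂(μ j)) atTop)
    (Eventually.of_forall fun n => ?_)
    (by isBoundedDefault) (by isBoundedDefault)).trans (liminf_const _).le
  refine le_trans ?_ (liminf_le_liminf (Eventually.of_forall fun j =>
    lintegral_mono (μ := μ j) (staircase_le h n))
    (by isBoundedDefault) (by isBoundedDefault))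
  simp_rw [lintegral_staircase hh]
  generalize (n + 1) ^ 2 = N
  induction N with
  | zero => simp
  | succ N ih =>
    simp_rw [Finset.sum_range_succ]
    refine le_trans (add_le_add ih ?_) (liminf_add_liminf_le _ _)
    rw [ENNReal.liminf_const_mul_of_ne_zero_of_ne_top (by simp) (by simp)]
    gcongr
    exact hopen _ (hh.isOpen_preimage _)

theorem VagueTendstoSeq.le_liminf_measure_isOpen [T2Space X] [LocallyCompactSpace X] [BorelSpace X]
    {μ : ℕ → Measure X} {ν : Measure X} [∀ j, IsFiniteMeasureOnCompacts (μ j)] [ν.Regular]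
    (hv : VagueTendstoSeq μ ν) {G : Set X} (hG : IsOpen G) :
    ν G ≤ liminf (fun j => μ j G) atTop := by
  rw [hG.measure_eq_iSup_isCompact]
  refine iSup₂_le fun K hKG => iSup_le fun hK => ?_
  obtain ⟨φ, hφ1, hφ0, hφc, hφ⟩ := exists_continuous_one_zero_of_isCompact hK
    hG.isClosed_compl (disjoint_compl_right_iff_subset.2 hKG)
  have hle : ∀ m : Measure X, IsFiniteMeasureOnCompacts m → m K ≤ ENNReal.ofReal (∫ x, φ x ∂m) ∧
      ENNReal.ofReal (∫ x, φ x ∂m) ≤ m G := by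
    intro m _
    have hfi : Integrable φ m := φ.continuous.integrable_of_hasCompactSupport hφc
    rw [ofReal_integral_eq_lintegral_ofReal hfi (Eventually.of_forall fun x => (hφ x).1)]
    constructor
    · rw [← lintegral_indicator_one hK.measurableSet]
      refine lintegral_mono fun x => ?_
      by_cases hx : x ∈ K
      · simp [hφ1 hx, hx]
      · simp [hx]
    · rw [← lintegral_indicator_one hG.measurableSet]
      refine lintegral_mono fun x => ?_
      by_cases hx : x ∈ G
      · simpa [hx] using (hφ x).2
      · simp [hφ0 hx]
  refine (hle ν inferInstance).1.trans ?_
  rw [← (ENNReal.tendsto_ofReal (hv φ φ.continuous hφc)).liminf_eq]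
  exact liminf_le_liminf (Eventually.of_forall fun j => (hle (μ j) inferInstance).2)
    (by isBoundedDefault) (by isBoundedDefault)

end Topological

theorem prod_eq_zero_of_not_aemeasurable {X : Type*} [MeasurableSpace X] {θ : Measure X}
    (h : ¬ AEMeasurable (fun x => Measure.map (Prod.mk x) θ) θ) : θ.prod θ = 0 := by
  rw [Measure.prod, Measure.bind, Measure.map_of_not_aemeasurable h, Measure.join_zero]

theorem restrict_prod_restrict_le {X : Type*} [MeasurableSpace X] {θ : Measure X}
    (h : AEMeasurable (fun x => Measure.map (Prod.mk x) θ) θ) (U : Set X)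
    [SFinite (θ.restrict U)] :
    (θ.restrict U).prod (θ.restrict U) ≤ θ.prod θ := by
  refine Measure.le_iff.2 fun s hs => ?_
  rw [Measure.prod_apply hs, Measure.prod, Measure.bind_apply hs h]
  refine lintegral_mono' Measure.restrict_le_self fun x => ?_
  rw [Measure.map_apply measurable_prodMk_left hs]
  exact Measure.restrict_le_self _

section Potentials

variable {X : Type*} [TopologicalSpace X]

/-- Open boxes `U ×ˢ V` together with a finite constant bounding the kernel below on the box. -/
structure KernelBox (κ : X → X → ℝ≥0∞) where
  bound : NNReal
  fst : Set X
  snd : Set X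
  isOpen_fst : IsOpen fst
  isOpen_snd : IsOpen snd
  le_kernel : ∀ x ∈ fst, ∀ y ∈ snd, (bound : ℝ≥0∞) ≤ κ x y

/-- The pointwise maximum of finitely many step functions on boxes. -/
def boxSup {κ : X → X → ℝ≥0∞} (F : Finset (KernelBox κ)) (p : X × X) : ℝ≥0∞ :=
  F.sup fun b => (b.fst ×ˢ b.snd).indicator (fun _ => (b.bound : ℝ≥0∞)) p

theorem boxSup_le {κ : X → X → ℝ≥0∞} (F : Finset (KernelBox κ)) (x y : X) :
    boxSup F (x, y) ≤ κ x y := by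
  refine Finset.sup_le fun b _ => ?_
  by_cases h : (x, y) ∈ b.fst ×ˢ b.snd
  · rw [Set.indicator_of_mem h]
    exact b.le_kernel x h.1 y h.2
  · simp [h]

theorem boxSup_mono {κ : X → X → ℝ≥0∞} : Monotone (boxSup (κ := κ)) :=
  fun _ _ h _ => Finset.sup_mono h

theorem lowerSemicontinuous_boxSup {κ : X → X → ℝ≥0∞} (F : Finset (KernelBox κ)) :
    LowerSemicontinuous (boxSup F) := by
  have : boxSup F = fun p => ⨆ b ∈ F, (b.fst ×ˢ b.snd).indicator
      (fun _ => (b.bound : ℝ≥0∞)) p := by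
    ext p; exact Finset.sup_eq_iSup _ _
  rw [this]
  exact lowerSemicontinuous_iSup fun b => lowerSemicontinuous_iSup fun _ =>
    (b.isOpen_fst.prod b.isOpen_snd).lowerSemicontinuous_indicator zero_le

theorem measurable_boxSup [MeasurableSpace X] [OpensMeasurableSpace X] {κ : X → X → ℝ≥0∞}
    (F : Finset (KernelBox κ)) : Measurable (boxSup F) := by
  have : boxSup F = F.sup fun b => (b.fst ×ˢ b.snd).indicator
      (fun _ => (b.bound : ℝ≥0∞)) := by
    ext p; rw [Finset.sup_apply]; rfl
  rw [this]
  exact Finset.sup_induction (p := Measurable) measurable_const (fun _ h _ h' => h.sup h') fun b _ => measurable_const.indicator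
    (b.isOpen_fst.measurableSet.prod b.isOpen_snd.measurableSet)

theorem IsKernel.iSup_boxSup {κ : X → X → ℝ≥0∞} (hker : IsKernel κ) (x y : X) :
    ⨆ F : Finset (KernelBox κ), boxSup F (x, y) = κ x y := by
  refine le_antisymm (iSup_le fun F => boxSup_le F x y) ?_
  refine le_of_forall_lt_imp_le_of_dense fun a ha => ?_
  lift a to NNReal using (ha.trans_le le_top).ne
  have hop := hker.2.isOpen_preimage (a : ℝ≥0∞)
  obtain ⟨U, V, hU, hV, hxU, hyV, hUV⟩ := isOpen_prod_iff.1 hop x y ha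
  let b : KernelBox κ := ⟨a, U, V, hU, hV, fun x' hx' y' hy' =>
    le_of_lt (hUV (Set.mk_mem_prod hx' hy'))⟩
  refine le_iSup_of_le {b} ?_
  have hmem : (x, y) ∈ b.fst ×ˢ b.snd := Set.mk_mem_prod hxU hyV
  simp [boxSup, b, hxU, hyV]

theorem IsKernel.lowerSemicontinuous_right {κ : X → X → ℝ≥0∞} (hker : IsKernel κ) (x : X) :
    LowerSemicontinuous (κ x) :=
  hker.2.comp (Continuous.prodMk_right x)

variable (X) in
/-- Open sets contained in a compact set. -/
abbrev PreOpens : Type _ := {U : Set X // IsOpen U ∧ ∃ K, IsCompact K ∧ U ⊆ K}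

instance : Nonempty (PreOpens X) := ⟨⟨∅, isOpen_empty, ∅, isCompact_empty, Subset.rfl⟩⟩

theorem directed_preOpens {β : Type*} [Preorder β] {g : PreOpens X → β}
    (hg : ∀ U V : PreOpens X, U.1 ⊆ V.1 → g U ≤ g V) : Directed (· ≤ ·) g := by
  rintro ⟨U, hU, K, hK, hUK⟩ ⟨V, hV, L, hL, hVL⟩
  exact ⟨⟨U ∪ V, hU.union hV, K ∪ L, hK.union hL, union_subset_union hUK hVL⟩,
    hg _ _ subset_union_left, hg _ _ subset_union_right⟩

variable [MeasurableSpace X]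

theorem lowerSemicontinuous_lintegral_boxSup {κ : X → X → ℝ≥0∞} (F : Finset (KernelBox κ))
    (σ : Measure X) : LowerSemicontinuous fun x => ∫⁻ y, boxSup F (x, y) ∂σ := by
  intro x₀ a ha
  have hev : ∀ᶠ x in 𝓝 x₀, ∀ b ∈ F, x₀ ∈ b.fst → x ∈ b.fst := by
    rw [Finset.eventually_all]
    intro b _
    by_cases h : x₀ ∈ b.fst
    · filter_upwards [b.isOpen_fst.mem_nhds h] with x hx _ using hx
    · exact Eventually.of_forall fun x hx => absurd hx h
  filter_upwards [hev] with x hx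
  refine lt_of_lt_of_le ha (lintegral_mono fun y => Finset.sup_mono_fun fun b hb => ?_)
  by_cases h : (x₀, y) ∈ b.fst ×ˢ b.snd
  · rw [Set.indicator_of_mem h, Set.indicator_of_mem (Set.mk_mem_prod (hx b hb h.1) h.2)]
  · simp [h]

variable {κ : X → X → ℝ≥0∞}

theorem IsKernel.potential_eq_iSup [OpensMeasurableSpace X] (hker : IsKernel κ) (σ : Measure X)
    [σ.Regular] (x : X) :
    potential κ σ x = ⨆ F : Finset (KernelBox κ), ∫⁻ y, boxSup F (x, y) ∂σ := by
  unfold potential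
  simp_rw [← hker.iSup_boxSup]
  exact lintegral_iSup_of_directed_lowerSemicontinuous σ
    (h := fun (F : Finset (KernelBox κ)) y => boxSup F (x, y))
    (fun F => (lowerSemicontinuous_boxSup F).comp (Continuous.prodMk_right x))
    (Monotone.directed_le fun F G h y => boxSup_mono h (x, y))

theorem IsKernel.lowerSemicontinuous_potential [OpensMeasurableSpace X] (hker : IsKernel κ)
    (σ : Measure X) [σ.Regular] : LowerSemicontinuous (potential κ σ) := by
  have : potential κ σ = fun x => ⨆ F : Finset (KernelBox κ), ∫⁻ y, boxSup F (x, y) ∂σ :=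
    funext (hker.potential_eq_iSup σ)
  rw [this]
  exact lowerSemicontinuous_iSup fun F => lowerSemicontinuous_lintegral_boxSup F σ

/-- Fubini's theorem for the mutual energy of finite Radon measures. -/
theorem IsKernel.mutualEnergy_eq_lintegral_potential [OpensMeasurableSpace X] (hker : IsKernel κ)
    (μ σ : Measure X) [μ.Regular] [σ.Regular] [SFinite μ] [SFinite σ] :
    mutualEnergy κ μ σ = ∫⁻ x, potential κ σ x ∂μ := by
  refine le_antisymm (lintegral_prod_le _) ?_
  simp_rw [hker.potential_eq_iSup σ]
  rw [lintegral_iSup_of_directed_lowerSemicontinuous μ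
    (fun F => lowerSemicontinuous_lintegral_boxSup F σ)
    (Monotone.directed_le fun F G h x => lintegral_mono fun y => boxSup_mono h (x, y))]
  refine iSup_le fun F => ?_
  rw [← lintegral_prod _ (measurable_boxSup F).aemeasurable]
  exact lintegral_mono fun p => boxSup_le F p.1 p.2

theorem PreOpens.measure_lt_top (U : PreOpens X) (θ : Measure X) [IsFiniteMeasureOnCompacts θ] :
    θ U.1 < ⊤ := by
  obtain ⟨U, hU, K, hK, hUK⟩ := U
  exact (measure_mono hUK).trans_lt hK.measure_lt_top

theorem IsKernel.potential_eq_iSup_restrict [OpensMeasurableSpace X] [LocallyCompactSpace X]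
    (hker : IsKernel κ) (θ : Measure X) [θ.Regular] (x : X) :
    potential κ θ x = ⨆ U : PreOpens X, potential κ (θ.restrict U.1) x := by
  have h1 : ∀ U : PreOpens X, potential κ (θ.restrict U.1) x =
      ∫⁻ y, U.1.indicator (κ x) y ∂θ := fun U =>
    (lintegral_indicator U.2.1.measurableSet _).symm
  simp_rw [h1]
  rw [← lintegral_iSup_of_directed_lowerSemicontinuous θ
    (h := fun (U : PreOpens X) y => U.1.indicator (κ x) y)]
  · refine lintegral_congr fun y => le_antisymm ?_ (iSup_le fun U => Set.indicator_le_self _ _ _)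
    obtain ⟨K, hK, hyK⟩ := exists_compact_mem_nhds y
    refine le_iSup_of_le ⟨interior K, isOpen_interior, K, hK, interior_subset⟩ ?_
    rw [Set.indicator_of_mem (mem_interior_iff_mem_nhds.2 hyK)]
  · intro U y a ha
    by_cases hy : y ∈ U.1
    · beta_reduce at ha
      rw [Set.indicator_of_mem hy] at ha
      filter_upwards [U.2.1.mem_nhds hy, hker.lowerSemicontinuous_right x y a ha] with z hz hz'
      rwa [Set.indicator_of_mem hz]
    · simp [hy] at ha
  · exact directed_preOpens fun U V h y => Set.indicator_le_indicator_of_subset h (by simp) y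

theorem regular_restrict_preOpens [BorelSpace X] [T2Space X] (θ : Measure X) [θ.Regular] (U : PreOpens X) :
    (θ.restrict U.1).Regular :=
  Measure.Regular.restrict_of_measure_ne_top (U.measure_lt_top θ).ne

theorem isFiniteMeasure_restrict_preOpens (θ : Measure X) [IsFiniteMeasureOnCompacts θ]
    (U : PreOpens X) : IsFiniteMeasure (θ.restrict U.1) :=
  isFiniteMeasure_restrict.2 (U.measure_lt_top θ).ne

theorem potential_mono {X : Type*} [MeasurableSpace X] {κ : X → X → ℝ≥0∞} {σ θ : Measure X}
    (h : σ ≤ θ) (x : X) : potential κ σ x ≤ potential κ θ x :=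
  lintegral_mono' h le_rfl

theorem IsKernel.lintegral_potential_eq_iSup [BorelSpace X] [T2Space X] [LocallyCompactSpace X]
    (hker : IsKernel κ) (θ μ : Measure X) [θ.Regular] [μ.Regular] [SFinite μ] :
    ∫⁻ x, potential κ θ x ∂μ = ⨆ U : PreOpens X, mutualEnergy κ μ (θ.restrict U.1) := by
  have := regular_restrict_preOpens θ
  have := isFiniteMeasure_restrict_preOpens θ
  simp_rw [hker.mutualEnergy_eq_lintegral_potential, hker.potential_eq_iSup_restrict θ]
  exact lintegral_iSup_of_directed_lowerSemicontinuous μ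
    (fun U => hker.lowerSemicontinuous_potential _)
    (directed_preOpens fun U V h x => potential_mono (Measure.restrict_mono h le_rfl) x)

theorem energy_restrict_le (hen : EnergyPrinciple κ) {θ : Measure X} (hθ : memEplus κ θ)
    (U : Set X) [SFinite (θ.restrict U)] : energy κ (θ.restrict U) ≤ energy κ θ := by
  by_cases h : AEMeasurable (fun x => Measure.map (Prod.mk x) θ) θ
  · exact lintegral_mono' (restrict_prod_restrict_le h U) le_rfl
  · have h0 : energy κ θ = 0 := by
      simp [energy, mutualEnergy, prod_eq_zero_of_not_aemeasurable h]
    have hz : memEplus κ (0 : Measure X) :=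
      ⟨(inferInstance : (0 : Measure X).Regular), by simp [energy, mutualEnergy]⟩
    have : θ = 0 := (hen θ 0 hθ hz).2 (by rw [h0]; simp [energy, mutualEnergy])
    simp [this, energy, mutualEnergy]

end Potentials

section MutualEnergy

variable {X : Type*} [MeasurableSpace X] {κ : X → X → ℝ≥0∞}

theorem mutualEnergy_add_left (μ μ' ν : Measure X) [SFinite μ] [SFinite μ'] [SFinite ν] :
    mutualEnergy κ (μ + μ') ν = mutualEnergy κ μ ν + mutualEnergy κ μ' ν := by
  unfold mutualEnergy
  rw [Measure.add_prod, lintegral_add_measure]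

theorem mutualEnergy_add_right (μ ν ν' : Measure X) [SFinite μ] [SFinite ν] [SFinite ν'] :
    mutualEnergy κ μ (ν + ν') = mutualEnergy κ μ ν + mutualEnergy κ μ ν' := by
  unfold mutualEnergy
  rw [Measure.prod_add, lintegral_add_measure]

theorem mutualEnergy_smul_left (t : NNReal) (μ ν : Measure X) [SFinite ν] :
    mutualEnergy κ (t • μ) ν = t * mutualEnergy κ μ ν := by
  unfold mutualEnergy
  rw [Measure.prod_smul_left, lintegral_smul_measure, ENNReal.smul_def, smul_eq_mul]

theorem mutualEnergy_smul_right (t : NNReal) (μ ν : Measure X) [SFinite ν] :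
    mutualEnergy κ μ (t • ν) = t * mutualEnergy κ μ ν := by
  unfold mutualEnergy
  rw [Measure.prod_smul_right, lintegral_smul_measure, ENNReal.smul_def, smul_eq_mul]

theorem mutualEnergy_comm (hsymm : ∀ x y, κ x y = κ y x) (μ ν : Measure X) [SFinite μ]
    [SFinite ν] : mutualEnergy κ μ ν = mutualEnergy κ ν μ := by
  unfold mutualEnergy
  rw [← Measure.prod_swap (μ := ν) (ν := μ)]
  have := lintegral_map_equiv (μ := ν.prod μ) (fun p : X × X => κ p.1 p.2)
    (MeasurableEquiv.prodComm (α := X) (β := X))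
  refine this.trans (lintegral_congr fun p => hsymm _ _)

theorem strongDist_comm (hsymm : ∀ x y, κ x y = κ y x) (μ ν : Measure X) [SFinite μ]
    [SFinite ν] : strongDist κ μ ν = strongDist κ ν μ := by
  unfold strongDist
  rw [mutualEnergy_comm hsymm μ ν, add_comm (energy κ μ).toReal]

variable [TopologicalSpace X]

theorem EnergyPrinciple.mutualEnergy_le (hen : EnergyPrinciple κ) {μ ν : Measure X}
    (hμ : memEplus κ μ) (hν : memEplus κ ν) : mutualEnergy κ μ ν ≤ energy κ μ + energy κ ν :=
  le_trans (le_mul_of_one_le_left' one_le_two) (hen μ ν hμ hν).1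

theorem EnergyPrinciple.mutualEnergy_ne_top (hen : EnergyPrinciple κ) {μ ν : Measure X}
    (hμ : memEplus κ μ) (hν : memEplus κ ν) : mutualEnergy κ μ ν ≠ ⊤ :=
  ((hen.mutualEnergy_le hμ hν).trans_lt (add_lt_top.2 ⟨hμ.2, hν.2⟩)).ne

theorem EnergyPrinciple.toReal_le (hen : EnergyPrinciple κ) {μ ν : Measure X}
    (hμ : memEplus κ μ) (hν : memEplus κ ν) :
    2 * (mutualEnergy κ μ ν).toReal ≤ (energy κ μ).toReal + (energy κ ν).toReal := by
  have := ENNReal.toReal_mono (add_lt_top.2 ⟨hμ.2, hν.2⟩).ne (hen μ ν hμ hν).1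
  rwa [ENNReal.toReal_mul, ENNReal.toReal_add hμ.2.ne hν.2.ne, ENNReal.toReal_ofNat] at this

theorem EnergyPrinciple.sq_strongDist (hen : EnergyPrinciple κ) {μ ν : Measure X}
    (hμ : memEplus κ μ) (hν : memEplus κ ν) : strongDist κ μ ν ^ 2 =
      (energy κ μ).toReal + (energy κ ν).toReal - 2 * (mutualEnergy κ μ ν).toReal :=
  Real.sq_sqrt (sub_nonneg.2 (hen.toReal_le hμ hν))

theorem EnergyPrinciple.eq_of_strongDist_eq_zero (hen : EnergyPrinciple κ) {μ ν : Measure X}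
    (hμ : memEplus κ μ) (hν : memEplus κ ν) (h : strongDist κ μ ν = 0) : μ = ν := by
  refine (hen μ ν hμ hν).2 ?_
  have h2 := hen.sq_strongDist hμ hν
  rw [h] at h2
  rw [← ENNReal.toReal_eq_toReal_iff' (ENNReal.mul_ne_top (by simp)
    (hen.mutualEnergy_ne_top hμ hν)) (add_lt_top.2 ⟨hμ.2, hν.2⟩).ne, ENNReal.toReal_mul,
    ENNReal.toReal_add hμ.2.ne hν.2.ne, ENNReal.toReal_ofNat]
  linarith

variable [BorelSpace X] [T2Space X]

/-- A quantitative form of the Cauchy–Schwarz inequality for the energy inner product. -/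
theorem EnergyPrinciple.mutualEnergy_toReal_le (hen : EnergyPrinciple κ)
    (hsymm : ∀ x y, κ x y = κ y x) {σ μ ν : Measure X} [IsFiniteMeasure σ] [IsFiniteMeasure μ]
    [IsFiniteMeasure ν] (hσ : memEplus κ σ) (hμ : memEplus κ μ) (hν : memEplus κ ν)
    {t : ℝ} (ht : 0 < t) :
    (mutualEnergy κ σ ν).toReal ≤ (mutualEnergy κ σ μ).toReal + (energy κ σ).toReal / (2 * t) +
      t * strongDist κ μ ν ^ 2 / 2 := by
  have := hσ.1
  have := hμ.1
  have := hν.1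
  unfold IsRadon at *
  lift t to NNReal using ht.le
  have e1 : energy κ (σ + t • μ) = energy κ σ + t * mutualEnergy κ σ μ +
      (t * mutualEnergy κ σ μ + t * (t * energy κ μ)) := by
    unfold energy
    rw [mutualEnergy_add_left, mutualEnergy_add_right, mutualEnergy_add_right,
      mutualEnergy_smul_left, mutualEnergy_smul_left, mutualEnergy_smul_right,
      mutualEnergy_smul_right, mutualEnergy_comm hsymm μ σ]
  have e2 : energy κ (t • ν) = t * (t * energy κ ν) := by
    unfold energy
    rw [mutualEnergy_smul_left, mutualEnergy_smul_right]
  have e3 : mutualEnergy κ (σ + t • μ) (t • ν) =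
      t * mutualEnergy κ σ ν + t * (t * mutualEnergy κ μ ν) := by
    rw [mutualEnergy_add_left, mutualEnergy_smul_left, mutualEnergy_smul_right,
      mutualEnergy_smul_right]
  have f1 := hσ.2.ne
  have f2 := hμ.2.ne
  have f3 := hν.2.ne
  have f4 := hen.mutualEnergy_ne_top hσ hμ
  have f5 := hen.mutualEnergy_ne_top hσ hν
  have f6 := hen.mutualEnergy_ne_top hμ hν
  have hα : memEplus κ (σ + t • μ) := by
    refine ⟨(inferInstance : (σ + t • μ).Regular), ?_⟩
    rw [e1]
    finiteness
  have hβ : memEplus κ (t • ν) := by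
    refine ⟨(inferInstance : (t • ν).Regular), ?_⟩
    rw [e2]
    finiteness
  have key := hen.toReal_le hα hβ
  rw [e1, e2, e3, ENNReal.toReal_add (by finiteness) (by finiteness),
    ENNReal.toReal_add (by finiteness) (by finiteness),
    ENNReal.toReal_add (by finiteness) (by finiteness),
    ENNReal.toReal_add (by finiteness) (by finiteness)] at key
  simp only [ENNReal.toReal_mul, ENNReal.coe_toReal] at key
  rw [hen.sq_strongDist hμ hν]
  have ht' : (t : ℝ) ≠ 0 := ht.ne'
  refine le_of_mul_le_mul_left (a := 2 * (t : ℝ)) ?_ (by positivity)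
  have : 2 * (t : ℝ) * ((energy κ σ).toReal / (2 * t)) = (energy κ σ).toReal := by
    field_simp
  rw [mul_add, mul_add, this]
  nlinarith

variable [LocallyCompactSpace X]

theorem IsKernel.lintegral_potential_lt_top (hker : IsKernel κ) (hen : EnergyPrinciple κ)
    {θ μ : Measure X} [IsFiniteMeasure μ] (hθ : memEplus κ θ) (hμ : memEplus κ μ) :
    ∫⁻ x, potential κ θ x ∂μ < ⊤ := by
  have : θ.Regular := hθ.1
  have : μ.Regular := hμ.1
  have := isFiniteMeasure_restrict_preOpens θ
  rw [hker.lintegral_potential_eq_iSup]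
  refine lt_of_le_of_lt (iSup_le fun U => ?_) (add_lt_top.2 ⟨hμ.2, hθ.2⟩)
  have hle := energy_restrict_le hen hθ U.1
  exact (hen.mutualEnergy_le hμ ⟨regular_restrict_preOpens θ U, hle.trans_lt hθ.2⟩).trans
    (by gcongr)

theorem IsKernel.lintegral_potential_toReal_le (hker : IsKernel κ) (hen : EnergyPrinciple κ)
    {θ μ ν : Measure X} [IsFiniteMeasure μ] [IsFiniteMeasure ν] (hθ : memEplus κ θ)
    (hμ : memEplus κ μ) (hν : memEplus κ ν) {t : ℝ} (ht : 0 < t) :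
    (∫⁻ x, potential κ θ x ∂ν).toReal ≤ (∫⁻ x, potential κ θ x ∂μ).toReal +
      ((energy κ θ).toReal / (2 * t) + t * strongDist κ μ ν ^ 2 / 2) := by
  have : θ.Regular := hθ.1
  have : μ.Regular := hμ.1
  have : ν.Regular := hν.1
  have := isFiniteMeasure_restrict_preOpens θ
  have hfin := hker.lintegral_potential_lt_top hen hθ hμ
  refine ENNReal.toReal_le_of_le_ofReal (by positivity) ?_
  rw [hker.lintegral_potential_eq_iSup θ ν]
  refine iSup_le fun U => ?_
  have hle := energy_restrict_le hen hθ U.1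
  have hU : memEplus κ (θ.restrict U.1) := ⟨regular_restrict_preOpens θ U, hle.trans_lt hθ.2⟩
  rw [mutualEnergy_comm hker.1]
  refine ENNReal.le_ofReal_iff_toReal_le (hen.mutualEnergy_ne_top hU hν) (by positivity) |>.2 ?_
  refine (hen.mutualEnergy_toReal_le hker.1 hU hμ hν ht).trans ?_
  rw [add_assoc]
  gcongr
  · exact hfin.ne
  · rw [hker.lintegral_potential_eq_iSup θ μ, mutualEnergy_comm hker.1]
    exact le_iSup (fun U : PreOpens X => mutualEnergy κ μ (θ.restrict U.1)) U
  · exact hθ.2.ne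

/-- Integration of a potential of finite energy is continuous in the strong metric. -/
theorem IsKernel.tendsto_lintegral_potential (hker : IsKernel κ) (hen : EnergyPrinciple κ)
    {θ ν : Measure X} {μ : ℕ → Measure X} [∀ j, IsFiniteMeasure (μ j)] [IsFiniteMeasure ν]
    (hθ : memEplus κ θ) (hμ : ∀ j, memEplus κ (μ j)) (hν : memEplus κ ν)
    (hlim : StrongTendstoSeq κ μ ν) :
    Tendsto (fun j => (∫⁻ x, potential κ θ x ∂(μ j)).toReal) atTop
      (𝓝 (∫⁻ x, potential κ θ x ∂ν).toReal) := by
  rw [Metric.tendsto_atTop']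
  intro ε hε
  have hC : 0 ≤ (energy κ θ).toReal := ENNReal.toReal_nonneg
  set C := (energy κ θ).toReal
  set t := (C + 1) / ε
  have ht : 0 < t := by positivity
  have h1 : C / (2 * t) < ε / 2 := by
    rw [div_lt_iff₀ (by positivity)]
    have : ε / 2 * (2 * t) = C + 1 := by simp only [t]; field_simp
    linarith
  have h2 : Tendsto (fun j => t * strongDist κ (μ j) ν ^ 2 / 2) atTop (𝓝 0) := by
    simpa using ((hlim.pow 2).const_mul t).div_const 2
  obtain ⟨N, hN⟩ := eventually_atTop.1 (h2.eventually_lt_const (half_pos hε))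
  refine ⟨N, fun j hj => ?_⟩
  have h3 := hN j hj.le
  have h4 := hker.lintegral_potential_toReal_le hen hθ (hμ j) hν ht
  have h5 := hker.lintegral_potential_toReal_le hen hθ hν (hμ j) ht
  rw [strongDist_comm hker.1 ν (μ j)] at h5
  rw [Real.dist_eq, abs_lt]
  constructor <;> linarith

theorem IsKernel.tendsto_energy (hker : IsKernel κ) (hen : EnergyPrinciple κ)
    {ν : Measure X} {μ : ℕ → Measure X} [∀ j, IsFiniteMeasure (μ j)] [IsFiniteMeasure ν]
    (hμ : ∀ j, memEplus κ (μ j)) (hν : memEplus κ ν) (hlim : StrongTendstoSeq κ μ ν) :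
    Tendsto (fun j => (energy κ (μ j)).toReal) atTop (𝓝 (energy κ ν).toReal) := by
  have : ν.Regular := hν.1
  have : ∀ j, (μ j).Regular := fun j => (hμ j).1
  have h1 := hker.tendsto_lintegral_potential hen hν hμ hν hlim
  simp_rw [← hker.mutualEnergy_eq_lintegral_potential] at h1
  have h2 : Tendsto (fun j => strongDist κ (μ j) ν ^ 2 - (energy κ ν).toReal +
      2 * (mutualEnergy κ (μ j) ν).toReal) atTop
      (𝓝 (0 ^ 2 - (energy κ ν).toReal + 2 * (mutualEnergy κ ν ν).toReal)) :=
    ((hlim.pow 2).sub_const _).add (h1.const_mul 2)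
  refine (h2.congr fun j => ?_).trans_eq ?_
  · rw [hen.sq_strongDist (hμ j) hν]
    ring
  · unfold energy
    congr 1
    ring

end MutualEnergy

section ExternalField

theorem exists_neg_le_of_lowerSemicontinuous {X : Type*} [TopologicalSpace X] {ψ : X → EReal}
    (hψ : LowerSemicontinuous ψ) (hbot : ∀ x, ψ x ≠ ⊥)
    (hpos : ¬ CompactSpace X → ∀ x, 0 ≤ ψ x) : ∃ c : ℝ, ∀ x, (-c : ℝ) ≤ ψ x := by
  by_cases hX : CompactSpace X
  · rcases isEmpty_or_nonempty X with h | h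
    · exact ⟨0, fun x => h.elim x⟩
    · obtain ⟨x₀, -, hx₀⟩ := LowerSemicontinuousOn.exists_isMinOn univ_nonempty isCompact_univ
        (hψ.lowerSemicontinuousOn univ)
      obtain ⟨c, hc⟩ := EReal.lt_iff_exists_real_btwn.1 (bot_lt_iff_ne_bot.2 (hbot x₀))
      exact ⟨-c, fun x => by
        rw [neg_neg]
        exact hc.2.le.trans (hx₀ (mem_univ x))⟩
  · exact ⟨0, by simpa using hpos hX⟩

theorem lowerSemicontinuous_toENNReal_add {X : Type*} [TopologicalSpace X] {ψ : X → EReal}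
    (hψ : LowerSemicontinuous ψ) (c : ℝ) :
    LowerSemicontinuous fun x => (ψ x + c).toENNReal := by
  have hcont : Continuous fun y : EReal => (y + c).toENNReal := by
    refine EReal.continuous_toENNReal.comp (continuous_iff_continuousAt.2 fun y => ?_)
    exact (EReal.continuousAt_add (p := (y, (c : EReal))) (by simp) (by simp)).comp
      (f := fun y : EReal => (y, (c : EReal))) (Continuous.prodMk_left _).continuousAt
  exact hcont.comp_lowerSemicontinuous hψ fun a b hab =>
    EReal.toENNReal_le_toENNReal (by gcongr)

variable {X : Type*} [MeasurableSpace X] {μ : Measure X} {f : X → EReal}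
  {h P M : X → ℝ≥0∞} {c : ℝ}

theorem ae_field_eq (hf : ∀ x, f x = ((h x : EReal) - (c : EReal)) + P x - M x)
    (hP : ∫⁻ x, P x ∂μ ≠ ⊤) (hM : ∫⁻ x, M x ∂μ ≠ ⊤) (hPm : Measurable P) (hMm : Measurable M) :
    ∀ᵐ x ∂μ, (f x ≠ ⊤ → h x ≠ ⊤) ∧
      (h x ≠ ⊤ → f x = (((h x).toReal - c + (P x).toReal - (M x).toReal : ℝ) : EReal)) := by
  filter_upwards [ae_lt_top hPm hP, ae_lt_top hMm hM] with x hx1 hx2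
  rw [hf x]
  generalize P x = p at *
  generalize M x = m at *
  generalize h x = y
  lift p to NNReal using hx1.ne
  lift m to NNReal using hx2.ne
  induction y with
  | top =>
    refine ⟨fun hne => absurd ?_ hne, fun hne => absurd rfl hne⟩
    have h1 : ((p : ℝ≥0∞) : EReal) = ((p : ℝ) : EReal) := rfl
    have h2 : ((m : ℝ≥0∞) : EReal) = ((m : ℝ) : EReal) := rfl
    rw [EReal.coe_ennreal_top, h1, h2, EReal.top_sub_coe, EReal.top_add_coe, EReal.top_sub_coe]
  | coe y =>
    refine ⟨fun _ => coe_ne_top, fun _ => ?_⟩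
    push_cast
    rfl

theorem lintegral_ne_top_of_fieldIntegrable [IsFiniteMeasure μ]
    (hf : ∀ x, f x = ((h x : EReal) - (c : EReal)) + P x - M x)
    (hP : ∫⁻ x, P x ∂μ ≠ ⊤) (hM : ∫⁻ x, M x ∂μ ≠ ⊤) (hPm : Measurable P) (hMm : Measurable M)
    (hfi : FieldIntegrable f μ) : ∫⁻ x, h x ∂μ ≠ ⊤ := by
  have hi : Integrable (fun x => (f x).toReal + c - (P x).toReal + (M x).toReal) μ :=
    ((hfi.1.add (integrable_const c)).sub
      (integrable_toReal_of_lintegral_ne_top hPm.aemeasurable hP)).add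
      (integrable_toReal_of_lintegral_ne_top hMm.aemeasurable hM)
  have : ∫⁻ x, h x ∂μ =
      ∫⁻ x, ENNReal.ofReal ((f x).toReal + c - (P x).toReal + (M x).toReal) ∂μ := by
    refine lintegral_congr_ae ?_
    filter_upwards [ae_field_eq hf hP hM hPm hMm, hfi.2] with x hx hx'
    have ht := hx.1 hx'.1
    rw [hx.2 ht, EReal.toReal_coe]
    ring_nf
    rw [ENNReal.ofReal_toReal ht]
  rw [this]
  exact hi.lintegral_lt_top.ne

theorem fieldIntegrable_of_lintegral_ne_top [IsProbabilityMeasure μ]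
    (hf : ∀ x, f x = ((h x : EReal) - (c : EReal)) + P x - M x)
    (hP : ∫⁻ x, P x ∂μ ≠ ⊤) (hM : ∫⁻ x, M x ∂μ ≠ ⊤) (hPm : Measurable P) (hMm : Measurable M)
    (hhm : Measurable h) (hh : ∫⁻ x, h x ∂μ ≠ ⊤) :
    FieldIntegrable f μ ∧ fieldIntegral f μ = (∫⁻ x, h x ∂μ).toReal - c +
      (∫⁻ x, P x ∂μ).toReal - (∫⁻ x, M x ∂μ).toReal := by
  have hae : ∀ᵐ x ∂μ, f x =
      (((h x).toReal - c + (P x).toReal - (M x).toReal : ℝ) : EReal) := by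
    filter_upwards [ae_field_eq hf hP hM hPm hMm, ae_lt_top hhm hh] with x hx hx'
    exact hx.2 hx'.ne
  have hae' : (fun x => (f x).toReal) =ᵐ[μ]
      fun x => (h x).toReal - c + (P x).toReal - (M x).toReal := by
    filter_upwards [hae] with x hx
    rw [hx, EReal.toReal_coe]
  have ih := integrable_toReal_of_lintegral_ne_top hhm.aemeasurable hh
  have iP := integrable_toReal_of_lintegral_ne_top hPm.aemeasurable hP
  have iM := integrable_toReal_of_lintegral_ne_top hMm.aemeasurable hM
  have ic : Integrable (fun _ : X => c) μ := integrable_const c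
  refine ⟨⟨(((ih.sub ic).add iP).sub iM).congr hae'.symm, ?_⟩, ?_⟩
  · filter_upwards [hae] with x hx
    rw [hx]
    exact ⟨EReal.coe_ne_top _, EReal.coe_ne_bot _⟩
  · unfold fieldIntegral
    rw [integral_congr_ae hae']
    have e1 := integral_sub ((ih.sub ic).add iP) iM
    have e2 := integral_add (ih.sub ic) iP
    simp only [Pi.add_apply, Pi.sub_apply] at e1 e2
    rw [e1, e2, integral_sub ih ic,
      integral_toReal hhm.aemeasurable (ae_lt_top hhm hh),
      integral_toReal hPm.aemeasurable (ae_lt_top hPm hP),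
      integral_toReal hMm.aemeasurable (ae_lt_top hMm hM)]
    simp

end ExternalField

section GaussFunctional

variable {X : Type*} [TopologicalSpace X] [MeasurableSpace X] {κ : X → X → ℝ≥0∞} {A : Set X}
  {f : X → EReal}

theorem wf_le {μ : Measure X} (hμ : Admissible κ A f μ) : wf κ A f ≤ (gaussI κ f μ : ℝ) :=
  iInf₂_le μ hμ

theorem exists_minimizing_seq (hw : wf κ A f < ⊤) : ∃ μ : ℕ → Measure X,
    (∀ j, Admissible κ A f (μ j)) ∧
      Tendsto (fun j => ((gaussI κ f (μ j) : ℝ) : EReal)) atTop (𝓝 (wf κ A f)) := by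
  have hwf : wf κ A f = sInf ((fun μ => ((gaussI κ f μ : ℝ) : EReal)) '' {μ | Admissible κ A f μ}) :=
    sInf_image.symm
  have hne : ((fun μ => ((gaussI κ f μ : ℝ) : EReal)) '' {μ | Admissible κ A f μ}).Nonempty := by
    rw [nonempty_iff_ne_empty]
    intro h
    rw [hwf, h, sInf_empty] at hw
    exact lt_irrefl _ hw
  obtain ⟨u, -, hu, hmem⟩ := exists_seq_tendsto_sInf hne (OrderBot.bddBelow _)
  choose μ hμ hμu using hmem
  refine ⟨μ, hμ, ?_⟩
  rw [hwf]
  exact hu.congr fun j => (hμu j).symm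

/-- If the strong and vague limit of the minimizing sequences is concentrated on `A` and has unit
mass, then it minimizes the Gauss functional. -/
theorem isSolution_of_concentrated [T2Space X] [LocallyCompactSpace X] [BorelSpace X]
    (hker : IsKernel κ) (hen : EnergyPrinciple κ) (hf : IsExternalField κ f)
    (hw : wf κ A f < ⊤) {ξ : Measure X} (hξ : memEplus κ ξ)
    (hext : ∀ μ : ℕ → Measure X, (∀ j, Admissible κ A f (μ j)) →
      Tendsto (fun j => ((gaussI κ f (μ j) : ℝ) : EReal)) atTop (𝓝 (wf κ A f)) →
      StrongTendstoSeq κ μ ξ ∧ VagueTendstoSeq μ ξ)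
    (hA : Concentrated ξ A) (hmass : ξ Set.univ = 1) : IsSolution κ A f ξ := by
  obtain ⟨ψ, ϑp, ϑm, hψ, hbot, hpos, hp, hm, hfψ⟩ := hf
  obtain ⟨c, hc⟩ := exists_neg_le_of_lowerSemicontinuous hψ hbot hpos
  obtain ⟨μ, hμ, hlim⟩ := exists_minimizing_seq hw
  obtain ⟨hstrong, hvague⟩ := hext μ hμ hlim
  have : ϑp.Regular := hp.1
  have : ϑm.Regular := hm.1
  have : ξ.Regular := hξ.1
  have : IsProbabilityMeasure ξ := ⟨hmass⟩
  have : ∀ j, (μ j).Regular := fun j => (hμ j).1.1.1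
  have : ∀ j, IsProbabilityMeasure (μ j) := fun j => ⟨(hμ j).1.2.2⟩
  set h : X → ℝ≥0∞ := fun x => (ψ x + c).toENNReal
  have hh : LowerSemicontinuous h := lowerSemicontinuous_toENNReal_add hψ c
  have hfh : ∀ x, f x = ((h x : EReal) - (c : EReal)) + potential κ ϑp x - potential κ ϑm x := by
    intro x
    have h0 : 0 ≤ ψ x + c := by
      have := add_le_add_left (hc x) (c : EReal)
      rwa [← EReal.coe_add, neg_add_cancel, EReal.coe_zero] at this
    rw [hfψ x, EReal.coe_toENNReal h0, EReal.add_sub_cancel_right]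
  have hPm := (hker.lowerSemicontinuous_potential ϑp).measurable
  have hMm := (hker.lowerSemicontinuous_potential ϑm).measurable
  have hE : ∀ j, memEplus κ (μ j) := fun j => (hμ j).1.1
  have hP := fun j => (hker.lintegral_potential_lt_top hen hp (hE j)).ne
  have hM := fun j => (hker.lintegral_potential_lt_top hen hm (hE j)).ne
  have hPξ := (hker.lintegral_potential_lt_top hen hp hξ).ne
  have hMξ := (hker.lintegral_potential_lt_top hen hm hξ).ne
  have hH : ∀ j, ∫⁻ x, h x ∂(μ j) ≠ ⊤ := fun j =>
    lintegral_ne_top_of_fieldIntegrable hfh (hP j) (hM j) hPm hMm (hμ j).2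
  have hfi := fun j =>
    (fieldIntegrable_of_lintegral_ne_top hfh (hP j) (hM j) hPm hMm hh.measurable (hH j)).2
  have hIlim := hker.tendsto_energy hen hE hξ hstrong
  have hPlim := hker.tendsto_lintegral_potential hen hp hE hξ hstrong
  have hMlim := hker.tendsto_lintegral_potential hen hm hE hξ hstrong
  have hrest := ((hIlim.div_const 2).sub_const c).add (hPlim.sub hMlim)
  have hG : ∀ j, gaussI κ f (μ j) = 2 * (∫⁻ x, h x ∂(μ j)).toReal +
      2 * ((energy κ (μ j)).toReal / 2 - c + ((∫⁻ x, potential κ ϑp x ∂(μ j)).toReal -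
        (∫⁻ x, potential κ ϑm x ∂(μ j)).toReal)) := by
    intro j
    rw [gaussI, hfi j]
    ring
  have hbotw : wf κ A f ≠ ⊥ := by
    refine ne_bot_of_le_ne_bot (EReal.coe_ne_bot _) (le_of_tendsto_of_tendsto'
      ((continuous_coe_real_ereal.tendsto _).comp (hrest.const_mul 2)) hlim fun j => ?_)
    refine EReal.coe_le_coe_iff.2 ?_
    rw [hG j]
    exact le_add_of_nonneg_left (by positivity)
  obtain ⟨w, hwr⟩ : ∃ w : ℝ, (w : EReal) = wf κ A f := ⟨_, EReal.coe_toReal hw.ne hbotw⟩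
  rw [← hwr, EReal.tendsto_coe] at hlim
  have hHlim := ((hlim.sub (hrest.const_mul 2)).div_const 2).congr
    (f₂ := fun j => (∫⁻ x, h x ∂(μ j)).toReal) fun j => by rw [hG j]; ring
  have hHnonneg := ge_of_tendsto' hHlim fun j => ENNReal.toReal_nonneg
  have hHlim' := ENNReal.tendsto_ofReal hHlim
  simp_rw [fun j => ENNReal.ofReal_toReal (hH j)] at hHlim'
  have hle := (lintegral_le_liminf_of_isOpen
    (fun G hG => hvague.le_liminf_measure_isOpen hG) hh).trans_eq hHlim'.liminf_eq
  have hHξ := (hle.trans_lt ENNReal.ofReal_lt_top).ne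
  obtain ⟨hFξ, hfiξ⟩ :=
    fieldIntegrable_of_lintegral_ne_top hfh hPξ hMξ hPm hMm hh.measurable hHξ
  have hadm : Admissible κ A f ξ := ⟨⟨hξ, hA, hmass⟩, hFξ⟩
  refine ⟨hadm, le_antisymm ?_ (wf_le hadm)⟩
  rw [← hwr, EReal.coe_le_coe_iff, gaussI, hfiξ]
  have := ENNReal.toReal_le_of_le_ofReal hHnonneg hle
  linarith

end GaussFunctional

theorem stmt17 {X : Type*} [TopologicalSpace X] [T2Space X] [LocallyCompactSpace X]
    [MeasurableSpace X] [BorelSpace X]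
    (κ : X → X → ℝ≥0∞) (f : X → EReal) (A : Set X)
    (hker : IsKernel κ) (hperf : IsPerfect κ) (hf : IsExternalField κ f)
    (hw : wf κ A f < ⊤)
    (ξ : Measure X) (hξ : memEplus κ ξ)
    (hext : ∀ μ : ℕ → Measure X, (∀ j, Admissible κ A f (μ j)) →
      Tendsto (fun j => ((gaussI κ f (μ j) : ℝ) : EReal)) atTop (𝓝 (wf κ A f)) →
      StrongTendstoSeq κ μ ξ ∧ VagueTendstoSeq μ ξ) :
    ((∃ l : Measure X, IsSolution κ A f l) ↔
      (Concentrated ξ A ∧ ξ Set.univ = 1)) ∧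
    ∀ l : Measure X, IsSolution κ A f l → l = ξ := by
  have hsol : ∀ l : Measure X, IsSolution κ A f l → l = ξ := by
    intro l hl
    have h := (hext (fun _ => l) (fun _ => hl.1) (by rw [hl.2]; exact tendsto_const_nhds)).1
    exact hperf.1.eq_of_strongDist_eq_zero hl.1.1.1 hξ (tendsto_nhds_unique tendsto_const_nhds h)
  refine ⟨⟨?_, fun hA => ⟨ξ, ?_⟩⟩, hsol⟩
  · rintro ⟨l, hl⟩
    have h := hl.1.1.2
    rwa [hsol l hl] at h
  · exact isSolution_of_concentrated hker hperf.1 hf hw hξ hext hA.1 hA.2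

end GaussVar
end
end

section
/- Let κ be a perfect kernel on X. If A ⊆ X is quasiclosed (or, in particular, quasicompact), then the cone E⁺(A) is closed in the strong metric d on E⁺; that is, if a sequence (or net) in E⁺(A) converges in d to some μ₀ ∈ E⁺, then μ₀ ∈ E⁺(A). -/
open MeasureTheory Topology Filter Set ENNReal

noncomputable section

namespace GaussVar

variable {X : Type*} [TopologicalSpace X] [MeasurableSpace X]

/-- The family of slices `x ↦ δ_x ⊗ μ`, whose barycentre with respect to `μ` is `μ ⊗ μ`. -/
def slices (μ : Measure X) (x : X) : Measure (X × X) := μ.map (Prod.mk x)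

lemma prod_eq_bind_slices {Y : Type*} [MeasurableSpace Y] (μ ν : Measure Y) :
    μ.prod ν = μ.bind (slices ν) := by
  rw [Measure.prod]; rfl

lemma mutualEnergy_smul_left_s19 {Y : Type*} [MeasurableSpace Y] (κ : Y → Y → ℝ≥0∞) (c : ℝ≥0∞)
    (μ ν : Measure Y) :
    mutualEnergy κ (c • μ) ν = c * mutualEnergy κ μ ν := by
  simp [mutualEnergy, prod_eq_bind_slices, Measure.bind_smul]

lemma energy_smul {Y : Type*} [MeasurableSpace Y] (κ : Y → Y → ℝ≥0∞) (c : ℝ≥0∞) {μ : Measure Y}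
    (h : AEMeasurable (slices μ) μ) :
    energy κ (c • μ) = c * (c * energy κ μ) := by
  have hc : Measurable fun m : Measure (Y × Y) => c • m :=
    Measure.measurable_of_measurable_coe _ fun s hs => by
      simpa using (Measure.measurable_coe hs).const_mul c
  have hs : slices (c • μ) = fun x => c • slices μ x := by
    ext1 x
    simp [slices, Measure.map_smul]
  have hbind : μ.bind (fun x => c • slices μ x) = c • μ.bind (slices μ) := by
    ext s ms
    rw [Measure.bind_apply (f := fun x => c • slices μ x) ms
        (hc.comp_aemeasurable h), Measure.smul_apply, Measure.bind_apply ms h]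
    simp only [Measure.smul_apply, smul_eq_mul]
    exact lintegral_const_mul'' c ((Measure.measurable_coe ms).comp_aemeasurable h)
  rw [energy, mutualEnergy_smul_left_s19, mutualEnergy, prod_eq_bind_slices, hs, hbind,
    lintegral_smul_measure, ← prod_eq_bind_slices]
  rfl

lemma energy_restrict_le_s19 {Y : Type*} [MeasurableSpace Y] (κ : Y → Y → ℝ≥0∞) {μ : Measure Y}
    (h : AEMeasurable (slices μ) μ) {K : Set Y} (hK : μ K ≠ ⊤) :
    energy κ (μ.restrict K) ≤ energy κ μ := by
  have : Fact (μ K < ⊤) := ⟨hK.lt_top⟩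
  refine lintegral_mono' (Measure.le_iff.2 fun s ms => ?_) le_rfl
  rw [Measure.prod_apply ms, prod_eq_bind_slices, Measure.bind_apply ms h]
  refine lintegral_mono' Measure.restrict_le_self fun x => ?_
  rw [slices, Measure.map_apply measurable_prodMk_left ms]
  exact Measure.restrict_le_self _

/-- The energy principle excludes finite-energy measures whose product measure degenerates. -/
lemma EnergyPrinciple.aemeasurable_slices {κ : X → X → ℝ≥0∞} (hκ : EnergyPrinciple κ)
    {μ : Measure X} (hμ : memEplus κ μ) : AEMeasurable (slices μ) μ := by
  by_contra h
  have hE : energy κ μ = 0 := by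
    rw [energy, mutualEnergy, prod_eq_bind_slices, Measure.bind, Measure.map_of_not_aemeasurable h]
    simp
  have hE₀ : energy κ (0 : Measure X) = 0 := by simp [energy, mutualEnergy]
  have h0 : memEplus κ (0 : Measure X) := ⟨inferInstanceAs (Measure.Regular 0), by simp [hE₀]⟩
  have hzero : μ = 0 := (hκ μ 0 hμ h0).2 (by
    rw [hE, hE₀, mutualEnergy, Measure.prod_zero]; simp)
  exact h (by rw [hzero]; exact aemeasurable_zero_measure)

/-- Capacity controls the mass that a measure of finite energy puts on an open set. -/
lemma EnergyPrinciple.measure_sq_le_mul_energy [T2Space X] [BorelSpace X]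
    {κ : X → X → ℝ≥0∞} (hκ : EnergyPrinciple κ) {μ : Measure X} (hμ : memEplus κ μ)
    {D : Set X} (hD : IsOpen D) {ε : ℝ≥0∞} (hε : ε ≠ ⊤) (hcap : innerCap κ D < ε) :
    μ D ^ 2 ≤ ε * energy κ μ := by
  have hreg : μ.Regular := hμ.1
  suffices hK : ∀ K ⊆ D, IsCompact K → μ K ^ 2 ≤ ε * energy κ μ by
    by_contra! hlt
    have hroot : (ε * energy κ μ) ^ (2⁻¹ : ℝ) < μ D := by
      rw [ENNReal.rpow_inv_lt_iff (by norm_num)]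
      simpa using hlt
    obtain ⟨K, hKD, hKc, hlt'⟩ := hD.exists_lt_isCompact hroot
    rw [ENNReal.rpow_inv_lt_iff (by norm_num)] at hlt'
    exact (hK K hKD hKc).not_gt (by simpa using hlt')
  intro K hKD hKc
  have hKtop : μ K ≠ ⊤ := hKc.measure_lt_top.ne
  rcases eq_or_ne (μ K) 0 with hK0 | hK0
  · simp [hK0]
  have : Fact (μ K < ⊤) := ⟨hKtop.lt_top⟩
  have hslices := hκ.aemeasurable_slices hμ
  have hrestr : AEMeasurable (slices (μ.restrict K)) (μ.restrict K) :=
    Measurable.map_prodMk_left.aemeasurable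
  set ν : Measure X := (μ K)⁻¹ • μ.restrict K with hν
  have hνE : energy κ ν ≤ (μ K)⁻¹ * ((μ K)⁻¹ * energy κ μ) := by
    rw [hν, energy_smul κ _ hrestr]
    gcongr
    exact energy_restrict_le_s19 κ hslices hKtop
  have hKinv : (μ K)⁻¹ ≠ ⊤ := ENNReal.inv_ne_top.2 hK0
  have hνreg : ν.Regular := by
    have := Measure.Regular.restrict_of_measure_ne_top (μ := μ) hKtop
    exact Measure.Regular.smul hKinv
  have hνD : memBreve κ D ν := by
    refine ⟨⟨hνreg, hνE.trans_lt ?_⟩, fun L _ => ?_, ?_⟩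
    · exact ENNReal.mul_lt_top hKinv.lt_top (ENNReal.mul_lt_top hKinv.lt_top hμ.2)
    · have : μ.restrict K (Dᶜ ∩ L) = 0 := by
        refine measure_mono_null inter_subset_left ?_
        rw [Measure.restrict_apply hD.measurableSet.compl,
          disjoint_compl_left_iff_subset.2 hKD |>.inter_eq, measure_empty]
      simp [hν, this]
    · simp [hν, ENNReal.inv_mul_cancel hK0 hKtop]
  have hinv : (energy κ ν)⁻¹ ≤ ε :=
    (ENNReal.inv_le_inv.2 (iInf₂_le ν hνD)).trans hcap.le
  have h1 : ε⁻¹ ≤ (μ K)⁻¹ * ((μ K)⁻¹ * energy κ μ) :=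
    (ENNReal.inv_le_iff_inv_le.1 hinv).trans hνE
  have hε0 : ε ≠ 0 := (zero_le.trans_lt hcap).ne'
  calc μ K ^ 2 = ε * (μ K ^ 2 * ε⁻¹) := by
        rw [mul_left_comm, ENNReal.mul_inv_cancel hε0 hε, mul_one]
    _ ≤ ε * (μ K ^ 2 * ((μ K)⁻¹ * ((μ K)⁻¹ * energy κ μ))) := by gcongr
    _ = ε * (((μ K) * (μ K)⁻¹) * (((μ K) * (μ K)⁻¹) * energy κ μ)) := by ring
    _ = ε * energy κ μ := by rw [ENNReal.mul_inv_cancel hK0 hKtop, one_mul, one_mul]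

/-- Energies are bounded on strong balls. -/
lemma EnergyPrinciple.energy_le_of_strongDist_le_one {κ : X → X → ℝ≥0∞} (hκ : EnergyPrinciple κ)
    {μ ν : Measure X} (hμ : memEplus κ μ) (hν : memEplus κ ν) (hd : strongDist κ μ ν ≤ 1) :
    energy κ μ ≤ 2 * (1 + energy κ ν) := by
  have hhalf : ((2 : ℝ≥0∞)⁻¹) ≠ ⊤ := by simp
  have hE := energy_smul κ (2 : ℝ≥0∞)⁻¹ (hκ.aemeasurable_slices hμ)
  have hmem : memEplus κ ((2 : ℝ≥0∞)⁻¹ • μ) := by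
    have : μ.Regular := hμ.1
    refine ⟨Measure.Regular.smul hhalf, ?_⟩
    rw [hE]
    exact ENNReal.mul_lt_top hhalf.lt_top (ENNReal.mul_lt_top hhalf.lt_top hμ.2)
  have hM := (hκ _ ν hmem hν).1
  rw [mutualEnergy_smul_left_s19, hE, ← mul_assoc, ENNReal.mul_inv_cancel (by simp) (by simp),
    one_mul] at hM
  have hMtop : mutualEnergy κ μ ν ≠ ⊤ := (hM.trans_lt (ENNReal.add_lt_top.2
    ⟨ENNReal.mul_lt_top hhalf.lt_top (ENNReal.mul_lt_top hhalf.lt_top hμ.2), hν.2⟩)).ne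
  rw [strongDist, Real.sqrt_le_one] at hd
  lift energy κ μ to NNReal using hμ.2.ne with a
  lift energy κ ν to NNReal using hν.2.ne with b
  lift mutualEnergy κ μ ν to NNReal using hMtop with m
  simp only [ENNReal.coe_toReal] at hd
  have hM' : m ≤ (2 : NNReal)⁻¹ * ((2 : NNReal)⁻¹ * a) + b := by
    rw [← ENNReal.coe_le_coe]
    push_cast
    simpa using hM
  have hM'' : (m : ℝ) ≤ 2⁻¹ * (2⁻¹ * a) + b := by exact_mod_cast hM'
  suffices h : a ≤ 2 * (1 + b) by exact_mod_cast h
  rw [← NNReal.coe_le_coe]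
  push_cast
  linarith

/-- Bounds on the masses that measures put on an open set `D` pass to the vague limit off a closed
set `F`, provided the measures live on a subset of `F ∪ D`. -/
lemma VagueTendstoSeq.measure_compl_le [T2Space X] [LocallyCompactSpace X] [BorelSpace X]
    {μ : ℕ → Measure X} {μ₀ : Measure X} (hvague : VagueTendstoSeq μ μ₀)
    (hμ : ∀ n, (μ n).Regular) (hμ₀ : μ₀.Regular) {A F D : Set X}
    (hA : ∀ n, Concentrated (μ n) A) (hF : IsClosed F) (hD : IsOpen D) (hAFD : A ⊆ F ∪ D)
    {s : ℝ≥0∞} (hs : ∀ᶠ n in atTop, μ n D ≤ s) : μ₀ Fᶜ ≤ s := by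
  rw [hF.isOpen_compl.measure_eq_iSup_isCompact]
  refine iSup₂_le fun K hKF => iSup_le fun hK => ?_
  obtain ⟨φ, hφK, hφF, hφc, hφ⟩ := exists_continuous_one_zero_of_isCompact hK hF
    (disjoint_left.2 fun x hx => hKF hx)
  have hint : ∀ ν : Measure X, ν.Regular →
      ENNReal.ofReal (∫ x, φ x ∂ν) = ∫⁻ x, ENNReal.ofReal (φ x) ∂ν := fun ν _ =>
    ofReal_integral_eq_lintegral_ofReal (φ.continuous.integrable_of_hasCompactSupport hφc)
      (Eventually.of_forall fun x => (hφ x).1)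
  have hlim : Tendsto (fun n => ENNReal.ofReal (∫ x, φ x ∂(μ n))) atTop
      (𝓝 (ENNReal.ofReal (∫ x, φ x ∂μ₀))) :=
    (ENNReal.continuous_ofReal.tendsto _).comp (hvague φ φ.continuous hφc)
  calc μ₀ K = ∫⁻ x, K.indicator 1 x ∂μ₀ := (lintegral_indicator_one hK.measurableSet).symm
    _ ≤ ∫⁻ x, ENNReal.ofReal (φ x) ∂μ₀ := by
        refine lintegral_mono (indicator_le fun x hx => ?_)
        simp [hφK hx]
    _ = ENNReal.ofReal (∫ x, φ x ∂μ₀) := (hint μ₀ hμ₀).symm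
    _ ≤ s := le_of_tendsto hlim ?_
  filter_upwards [hs] with n hn
  rw [hint _ (hμ n)]
  refine le_trans ?_ hn
  rw [← lintegral_indicator_one hD.measurableSet]
  have hnull : ∀ᵐ x ∂(μ n), x ∉ Aᶜ ∩ tsupport φ := measure_eq_zero_iff_ae_notMem.1 (hA n _ hφc)
  refine lintegral_mono_ae ?_
  filter_upwards [hnull] with x hx
  by_cases hxD : x ∈ D
  · simpa [hxD] using (hφ x).2
  · have : φ x = 0 := by
      by_contra h0
      have hxA : x ∈ A := by
        by_contra hxA
        exact hx ⟨hxA, subset_tsupport _ h0⟩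
      exact h0 (hφF ((hAFD hxA).resolve_right hxD))
    simp [this]

theorem stmt19 {X : Type*} [TopologicalSpace X] [T2Space X] [LocallyCompactSpace X]
    [MeasurableSpace X] [BorelSpace X]
    (κ : X → X → ℝ≥0∞) (A : Set X)
    (hker : IsKernel κ) (hperf : IsPerfect κ)
    (hqc : Quasiclosed κ A) :
    StrongClosedEplusOn κ A := by
  intro μ μ₀ hμ hμ₀ hlim
  obtain ⟨hκ, -, hvague⟩ := hperf
  have hvag := hvague μ μ₀ (fun n => (hμ n).1) hμ₀ hlim
  have hM₀ : 2 * (1 + energy κ μ₀) ≠ ⊤ :=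
    ENNReal.mul_ne_top (by simp) (ENNReal.add_ne_top.2 ⟨by simp, hμ₀.2.ne⟩)
  generalize hM : 2 * (1 + energy κ μ₀) = M at hM₀
  have hE : ∀ᶠ n in atTop, energy κ (μ n) ≤ M := by
    filter_upwards [hlim.eventually_le_const one_pos] with n hn
    exact hM ▸ hκ.energy_le_of_strongDist_le_one (hμ n).1 hμ₀ hn
  have hE₀ : energy κ μ₀ ≤ M := by
    rw [← hM, two_mul]
    exact le_add_right le_add_self
  have hM0 : M ≠ 0 := by simp [← hM]
  intro K _
  suffices h : ∀ s : NNReal, 0 < s → μ₀ (Aᶜ ∩ K) ≤ 0 + (s : ℝ≥0∞) by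
    exact le_zero_iff.1 (ENNReal.le_of_forall_pos_le_add fun s hs _ => h s hs)
  intro s hs
  set t : ℝ≥0∞ := ((s / 2 : NNReal) : ℝ≥0∞) with ht
  have ht0 : t ≠ 0 := by
    rw [ht, ENNReal.coe_ne_zero]
    positivity
  have hε0 : t ^ 2 / M ≠ 0 := (ENNReal.div_pos (pow_ne_zero 2 ht0) hM₀).ne'
  have hεtop : t ^ 2 / M ≠ ⊤ :=
    ENNReal.div_ne_top (ENNReal.pow_ne_top ENNReal.coe_ne_top) hM0
  obtain ⟨F, hF, hcap⟩ := hqc (t ^ 2 / M) (pos_iff_ne_zero.2 hε0)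
  simp only [outerCap, iInf_lt_iff] at hcap
  obtain ⟨D, ⟨hD, hAD⟩, hcapD⟩ := hcap
  have hmass : ∀ ν : Measure X, memEplus κ ν → energy κ ν ≤ M → ν D ≤ t := fun ν hν hνM => by
    refine (ENNReal.pow_le_pow_left_iff two_ne_zero).1 ?_
    calc ν D ^ 2 ≤ t ^ 2 / M * energy κ ν := hκ.measure_sq_le_mul_energy hν hD hεtop hcapD
      _ ≤ t ^ 2 / M * M := by gcongr
      _ = t ^ 2 := ENNReal.div_mul_cancel hM0 hM₀
  have hAFD : A ⊆ F ∪ D := fun x hx => by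
    by_cases hxF : x ∈ F
    · exact Or.inl hxF
    · exact Or.inr (hAD (Or.inl ⟨hx, hxF⟩))
  have hFc : μ₀ Fᶜ ≤ t := hvag.measure_compl_le (fun n => (hμ n).1.1) hμ₀.1 (fun n => (hμ n).2)
    hF hD hAFD (hE.mono fun n hn => hmass _ (hμ n).1 hn)
  have hcover : Aᶜ ∩ K ⊆ Fᶜ ∪ D := fun x hx => by
    by_cases hxF : x ∈ F
    · exact Or.inr (hAD (Or.inr ⟨hxF, hx.1⟩))
    · exact Or.inl hxF
  calc μ₀ (Aᶜ ∩ K) ≤ μ₀ Fᶜ + μ₀ D := (measure_mono hcover).trans (measure_union_le _ _)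
    _ ≤ t + t := add_le_add hFc (hmass μ₀ hμ₀ hE₀)
    _ = 0 + (s : ℝ≥0∞) := by rw [ht, zero_add, ← ENNReal.coe_add, add_halves]

end GaussVar
end
end
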